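/- arXiv:2011.05931 — 2 statements merged into one kernel-verified Lean document; each statement's English description precedes it below -/
import Mathlib

section
/- Consider a discrete Poisson channel with memory of order K ≥ 1, channel coefficients π ∈ (0,∞)^K (all π_j strictly positive) and dark noise d > 0, and let N ≥ 1. Then there exists a constant A* > 0 (depending only on N, K, π and d) such that for every peak power A ≥ A* the following holds: for every pair of codewords x1, x2 ∈ [0, A]^N, one has P_e(x1* * π, x2* * π) ≤ P_e(x1 * π, x2 * π), where x1* = (A, A, …, A) ∈ [0,A]^N and x2* = (0, 0, …, 0); that is, the on/off pair (x1*, x2*) minimizes the maximum-likelihood error probability among all codeword pairs satisfying the peak-power constraint A. -/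
open scoped BigOperators

/-- Poisson probability mass at `k` for mean `a`. -/
noncomputable def poissonPdf (a : ℝ) (k : ℕ) : ℝ :=
  Real.exp (-a) * a ^ k / (Nat.factorial k : ℝ)

/-- Joint pmf of independent Poisson coordinates with mean vector `m`. -/
noncomputable def prodPdf {n : ℕ} (m : Fin n → ℝ) (y : Fin n → ℕ) : ℝ :=
  ∏ i, poissonPdf (m i) (y i)

/-- Average error probability of a decoder `g` for the binary hypothesis test between
independent Poisson observations with mean vectors `lam + d` (hypothesis 1) and
`mu + d` (hypothesis 2); `g y = true` means "decide hypothesis 1". -/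
noncomputable def errProb {n : ℕ} (d : ℝ) (lam mu : Fin n → ℝ)
    (g : (Fin n → ℕ) → Bool) : ℝ :=
  (1/2) * (∑' y : Fin n → ℕ, if g y = false then prodPdf (fun i => lam i + d) y else 0)
  + (1/2) * (∑' y : Fin n → ℕ, if g y = true then prodPdf (fun i => mu i + d) y else 0)

/-- Minimal (maximum-likelihood) average error probability. -/
noncomputable def Pe {n : ℕ} (d : ℝ) (lam mu : Fin n → ℝ) : ℝ :=
  ⨅ g : (Fin n → ℕ) → Bool, errProb d lam mu g

/-- Convolution of a codeword `x` of length `N` with channel coefficients `p` of length `K`,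
giving the mean vector of length `N + K - 1`. -/
noncomputable def cconv {N K : ℕ} (x : Fin N → ℝ) (p : Fin K → ℝ) :
    Fin (N + K - 1) → ℝ :=
  fun i => ∑ j : Fin K,
    p j * (if h : (j : ℕ) ≤ (i : ℕ) ∧ (i : ℕ) - (j : ℕ) < N
      then x ⟨(i : ℕ) - (j : ℕ), h.2⟩ else 0)

/-- Sum of the `k` largest entries of `v`. -/
noncomputable def topSum {m : ℕ} (v : Fin m → ℝ) (k : ℕ) : ℝ :=
  ⨆ s ∈ {s : Finset (Fin m) | s.card = k}, ∑ i ∈ s, v i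

/-- Weak submajorization (from below): every top-`k` sum of `u` is at most that of `v`. -/
def weakSubmaj {m : ℕ} (u v : Fin m → ℝ) : Prop :=
  ∀ k, 1 ≤ k → k ≤ m → topSum u k ≤ topSum v k

open scoped ENNReal

theorem ENNReal.tsum_pi_prod {n : ℕ} (f : Fin n → ℕ → ℝ≥0∞) :
    ∑' y : Fin n → ℕ, ∏ i, f i (y i) = ∏ i, ∑' k, f i k := by
  induction n with
  | zero => simp
  | succ n ih =>
    rw [← (Fin.consEquiv fun _ : Fin (n + 1) => ℕ).tsum_eq, ENNReal.tsum_prod']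
    simp [Fin.prod_univ_succ, Fin.consEquiv, ENNReal.tsum_mul_left, ENNReal.tsum_mul_right, ih]

theorem ENNReal.tsum_eq_tsum_nat_add {f : ℕ → ℝ≥0∞} {l : ℕ} (hf : ∀ k < l, f k = 0) :
    ∑' k, f k = ∑' j, f (j + l) := by
  rw [← Summable.sum_add_tsum_nat_add' (f := f) (k := l) ENNReal.summable,
    Finset.sum_eq_zero fun k hk => hf k (Finset.mem_range.1 hk), zero_add]

theorem poissonPdf_nonneg {a : ℝ} (ha : 0 ≤ a) (k : ℕ) : 0 ≤ poissonPdf a k := by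
  unfold poissonPdf; positivity

theorem prodPdf_nonneg {n : ℕ} {m : Fin n → ℝ} (hm : ∀ i, 0 ≤ m i) (y : Fin n → ℕ) :
    0 ≤ prodPdf m y :=
  Finset.prod_nonneg fun i _ => poissonPdf_nonneg (hm i) _

theorem hasSum_pow_div_factorial (a : ℝ) :
    HasSum (fun k : ℕ => a ^ k / (Nat.factorial k : ℝ)) (Real.exp a) := by
  rw [Real.exp_eq_exp_ℝ]
  exact NormedSpace.expSeries_div_hasSum_exp a

theorem hasSum_poissonPdf (a : ℝ) : HasSum (poissonPdf a) 1 := by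
  have h := (hasSum_pow_div_factorial a).mul_left (Real.exp (-a))
  rw [← Real.exp_add, neg_add_cancel, Real.exp_zero] at h
  exact h.congr_fun fun k => by simp [poissonPdf, mul_div_assoc]

theorem tsum_ofReal_poissonPdf {a : ℝ} (ha : 0 ≤ a) :
    ∑' k, ENNReal.ofReal (poissonPdf a k) = 1 := by
  rw [← ENNReal.ofReal_tsum_of_nonneg (poissonPdf_nonneg ha) (hasSum_poissonPdf a).summable,
    (hasSum_poissonPdf a).tsum_eq, ENNReal.ofReal_one]

theorem ofReal_prodPdf {n : ℕ} {m : Fin n → ℝ} (hm : ∀ i, 0 ≤ m i) (y : Fin n → ℕ) :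
    ENNReal.ofReal (prodPdf m y) = ∏ i, ENNReal.ofReal (poissonPdf (m i) (y i)) :=
  ENNReal.ofReal_prod_of_nonneg fun i _ => poissonPdf_nonneg (hm i) _

theorem tsum_ofReal_prodPdf {n : ℕ} {m : Fin n → ℝ} (hm : ∀ i, 0 ≤ m i) :
    ∑' y, ENNReal.ofReal (prodPdf m y) = 1 := by
  simp [ofReal_prodPdf hm, ENNReal.tsum_pi_prod fun i k => ENNReal.ofReal (poissonPdf (m i) k),
    tsum_ofReal_poissonPdf (hm _)]

theorem summable_prodPdf {n : ℕ} {m : Fin n → ℝ} (hm : ∀ i, 0 ≤ m i) :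
    Summable (prodPdf m) := by
  have h : ∑' y, ENNReal.ofReal (prodPdf m y) ≠ ∞ := by simp [tsum_ofReal_prodPdf hm]
  exact (ENNReal.summable_toReal h).congr fun y =>
    (ENNReal.toReal_ofReal (prodPdf_nonneg hm y))

/-- The overlap `∑ min(P, Q)` of the two product Poisson laws with mean vectors `a` and `b`. -/
noncomputable def poissonOverlap {n : ℕ} (a b : Fin n → ℝ) : ℝ≥0∞ :=
  ∑' y, min (ENNReal.ofReal (prodPdf a y)) (ENNReal.ofReal (prodPdf b y))

theorem poissonOverlap_comm {n : ℕ} (a b : Fin n → ℝ) :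
    poissonOverlap a b = poissonOverlap b a := by
  simp [poissonOverlap, min_comm]

theorem poissonOverlap_le_one {n : ℕ} {a : Fin n → ℝ} (ha : ∀ i, 0 ≤ a i) (b : Fin n → ℝ) :
    poissonOverlap a b ≤ 1 :=
  (ENNReal.tsum_le_tsum fun _ => min_le_left _ _).trans_eq (tsum_ofReal_prodPdf ha)

theorem Pe_eq_poissonOverlap {n : ℕ} {d : ℝ} {lam mu : Fin n → ℝ}
    (hl : ∀ i, 0 ≤ lam i + d) (hm : ∀ i, 0 ≤ mu i + d) :
    Pe d lam mu =
      (poissonOverlap (fun i => lam i + d) (fun i => mu i + d)).toReal / 2 := by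
  classical
  set P := prodPdf fun i => lam i + d with hP
  set Q := prodPdf fun i => mu i + d with hQ
  have hP0 : ∀ y, 0 ≤ P y := prodPdf_nonneg hl
  have hQ0 : ∀ y, 0 ≤ Q y := prodPdf_nonneg hm
  have hPs : Summable P := summable_prodPdf hl
  have hQs : Summable Q := summable_prodPdf hm
  have hmin0 : ∀ y, 0 ≤ min (P y) (Q y) := fun y => le_min (hP0 y) (hQ0 y)
  have hmins : Summable fun y => min (P y) (Q y) :=
    Summable.of_nonneg_of_le hmin0 (fun y => min_le_left _ _) hPs
  have hov : (poissonOverlap (fun i => lam i + d) (fun i => mu i + d)).toReal =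
      ∑' y, min (P y) (Q y) := by
    unfold poissonOverlap
    simp_rw [← hP, ← hQ, ← ENNReal.ofReal_min]
    rw [← ENNReal.ofReal_tsum_of_nonneg hmin0 hmins, ENNReal.toReal_ofReal (tsum_nonneg hmin0)]
  have herr : ∀ g : (Fin n → ℕ) → Bool,
      errProb d lam mu g = (∑' y, if g y = false then P y else Q y) / 2 := by
    intro g
    have h1 : Summable fun y => if g y = false then P y else 0 :=
      Summable.of_nonneg_of_le (fun y => by split_ifs <;> simp [hP0])
        (fun y => by split_ifs <;> simp [hP0]) hPs
    have h2 : Summable fun y => if g y = true then Q y else 0 :=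
      Summable.of_nonneg_of_le (fun y => by split_ifs <;> simp [hQ0])
        (fun y => by split_ifs <;> simp [hQ0]) hQs
    have : (fun y => if g y = false then P y else Q y) = fun y =>
        (if g y = false then P y else 0) + (if g y = true then Q y else 0) := by
      ext y; cases g y <;> simp
    rw [this, h1.tsum_add h2]
    simp only [errProb, ← hP, ← hQ]
    ring
  have hlow : ∀ g, (∑' y, min (P y) (Q y)) / 2 ≤ errProb d lam mu g := by
    intro g
    rw [herr]
    refine div_le_div_of_nonneg_right ?_ zero_le_two
    refine Summable.tsum_le_tsum (fun y => ?_) hmins ?_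
    · split_ifs <;> simp
    · refine Summable.of_nonneg_of_le (fun y => ?_) (fun y => ?_) (hPs.add hQs)
      · split_ifs <;> simp [hP0, hQ0]
      · split_ifs <;> simp [hP0, hQ0]
  rw [hov]
  refine le_antisymm ?_ (le_ciInf hlow)
  refine (ciInf_le ⟨_, Set.forall_mem_range.2 hlow⟩ fun y => decide (Q y ≤ P y)).trans_eq ?_
  rw [herr]
  congr 2
  ext y
  by_cases h : Q y ≤ P y
  · simp [h]
  · simp [h, (not_le.1 h).le]

/-- Data processing: coordinatewise Markov kernels do not decrease the overlap. -/
theorem poissonOverlap_le_of_kernel {n : ℕ} {a b a' b' : Fin n → ℝ}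
    (ha : ∀ i, 0 ≤ a i) (hb : ∀ i, 0 ≤ b i) (ha' : ∀ i, 0 ≤ a' i) (hb' : ∀ i, 0 ≤ b' i)
    (W : Fin n → ℕ → ℕ → ℝ≥0∞) (hW : ∀ i k, ∑' l, W i k l = 1)
    (hWa : ∀ i l, ∑' k, ENNReal.ofReal (poissonPdf (a i) k) * W i k l =
      ENNReal.ofReal (poissonPdf (a' i) l))
    (hWb : ∀ i l, ∑' k, ENNReal.ofReal (poissonPdf (b i) k) * W i k l =
      ENNReal.ofReal (poissonPdf (b' i) l)) :
    poissonOverlap a b ≤ poissonOverlap a' b' := by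
  have push : ∀ {c c' : Fin n → ℝ}, (∀ i, 0 ≤ c i) → (∀ i, 0 ≤ c' i) →
      (∀ i l, ∑' k, ENNReal.ofReal (poissonPdf (c i) k) * W i k l =
        ENNReal.ofReal (poissonPdf (c' i) l)) → ∀ z : Fin n → ℕ,
      ∑' y : Fin n → ℕ, ENNReal.ofReal (prodPdf c y) * ∏ i, W i (y i) (z i) =
        ENNReal.ofReal (prodPdf c' z) := by
    intro c c' hc hc' h z
    simp_rw [ofReal_prodPdf hc, ofReal_prodPdf hc', ← Finset.prod_mul_distrib, ← h]
    exact ENNReal.tsum_pi_prod fun i k => ENNReal.ofReal (poissonPdf (c i) k) * W i k (z i)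
  calc poissonOverlap a b
      = ∑' y : Fin n → ℕ, ∑' z : Fin n → ℕ,
          min (ENNReal.ofReal (prodPdf a y)) (ENNReal.ofReal (prodPdf b y)) *
            ∏ i, W i (y i) (z i) := by
        refine tsum_congr fun y => ?_
        rw [ENNReal.tsum_mul_left, ENNReal.tsum_pi_prod fun i l => W i (y i) l]
        simp [hW]
    _ = ∑' z : Fin n → ℕ, ∑' y : Fin n → ℕ,
          min (ENNReal.ofReal (prodPdf a y)) (ENNReal.ofReal (prodPdf b y)) *
            ∏ i, W i (y i) (z i) := ENNReal.tsum_comm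
    _ ≤ poissonOverlap a' b' := by
        refine ENNReal.tsum_le_tsum fun z => le_min ?_ ?_
        · rw [← push ha ha' hWa z]
          exact ENNReal.tsum_le_tsum fun y => by gcongr; exact min_le_left _ _
        · rw [← push hb hb' hWb z]
          exact ENNReal.tsum_le_tsum fun y => by gcongr; exact min_le_right _ _

theorem poissonPdf_mul_binomial (a t : ℝ) (l j : ℕ) :
    poissonPdf a (l + j) * (((l + j).choose l : ℝ) * t ^ l * (1 - t) ^ j) =
      poissonPdf (t * a) l * poissonPdf ((1 - t) * a) j := by
  have hexp : Real.exp (-a) = Real.exp (-(t * a)) * Real.exp (-((1 - t) * a)) := by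
    rw [← Real.exp_add]; ring_nf
  have h : ((l + j).choose l : ℝ) * l.factorial * j.factorial = (l + j).factorial := by
    rw [Nat.choose_symm_add]
    exact_mod_cast Nat.add_choose_mul_factorial_mul_factorial l j
  have h1 : (l.factorial : ℝ) ≠ 0 := by positivity
  have h2 : (j.factorial : ℝ) ≠ 0 := by positivity
  have h3 : ((l + j).factorial : ℝ) ≠ 0 := by positivity
  unfold poissonPdf
  rw [hexp, mul_pow, mul_pow, pow_add]
  field_simp
  rw [← h]
  ring

/-- Independent thinning of counts with survival probability `t`. -/
theorem poissonOverlap_le_thinning {n : ℕ} {a b t : Fin n → ℝ}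
    (ha : ∀ i, 0 ≤ a i) (hb : ∀ i, 0 ≤ b i) (ht : ∀ i, 0 ≤ t i) (ht1 : ∀ i, t i ≤ 1) :
    poissonOverlap a b ≤ poissonOverlap (fun i => t i * a i) (fun i => t i * b i) := by
  have hmix : ∀ i (c : ℝ), 0 ≤ c → ∀ l, ∑' k, ENNReal.ofReal (poissonPdf c k) *
      ENNReal.ofReal ((k.choose l : ℝ) * t i ^ l * (1 - t i) ^ (k - l)) =
        ENNReal.ofReal (poissonPdf (t i * c) l) := by
    intro i c hc l
    have h1t : 0 ≤ 1 - t i := sub_nonneg.2 (ht1 i)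
    have hti := ht i
    rw [ENNReal.tsum_eq_tsum_nat_add (l := l)]
    · have : ∀ j, ENNReal.ofReal (poissonPdf c (j + l)) *
          ENNReal.ofReal (((j + l).choose l : ℝ) * t i ^ l * (1 - t i) ^ (j + l - l)) =
          ENNReal.ofReal (poissonPdf (t i * c) l) *
            ENNReal.ofReal (poissonPdf ((1 - t i) * c) j) := by
        intro j
        rw [← ENNReal.ofReal_mul (poissonPdf_nonneg hc _),
          ← ENNReal.ofReal_mul (poissonPdf_nonneg (by positivity) _),
          ← poissonPdf_mul_binomial, add_comm j l, Nat.add_sub_cancel_left]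
      simp_rw [this]
      rw [ENNReal.tsum_mul_left, tsum_ofReal_poissonPdf (by positivity), mul_one]
    · intro k hk
      simp [Nat.choose_eq_zero_of_lt hk]
  refine poissonOverlap_le_of_kernel ha hb (fun i => mul_nonneg (ht i) (ha i))
    (fun i => mul_nonneg (ht i) (hb i))
    (fun i k l => ENNReal.ofReal ((k.choose l : ℝ) * t i ^ l * (1 - t i) ^ (k - l)))
    (fun i k => ?_) (fun i => hmix i _ (ha i)) (fun i => hmix i _ (hb i))
  have h1t : 0 ≤ 1 - t i := sub_nonneg.2 (ht1 i)
  have hti := ht i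
  rw [tsum_eq_sum (s := Finset.range (k + 1)), ← ENNReal.ofReal_sum_of_nonneg]
  · have h := add_pow (t i) (1 - t i) k
    rw [add_sub_cancel, one_pow] at h
    refine (congrArg ENNReal.ofReal (Eq.trans ?_ h.symm)).trans ENNReal.ofReal_one
    exact Finset.sum_congr rfl fun l _ => by ring
  · intros; positivity
  · intro l hl
    simp only [Finset.mem_range, not_lt] at hl
    simp [Nat.choose_eq_zero_of_lt hl]

theorem sum_poissonPdf_mul_poissonPdf (a b : ℝ) (l : ℕ) :
    ∑ k ∈ Finset.range (l + 1), poissonPdf a k * poissonPdf b (l - k) =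
      poissonPdf (a + b) l := by
  have hexp : Real.exp (-(a + b)) = Real.exp (-a) * Real.exp (-b) := by
    rw [← Real.exp_add]; ring_nf
  unfold poissonPdf
  rw [hexp, add_pow, Finset.mul_sum, Finset.sum_div]
  refine Finset.sum_congr rfl fun k hk => ?_
  have hk' : k ≤ l := Nat.lt_succ_iff.1 (Finset.mem_range.1 hk)
  have h : (l.choose k : ℝ) * k.factorial * (l - k).factorial = l.factorial := by
    exact_mod_cast Nat.choose_mul_factorial_mul_factorial hk'
  have h1 : (k.factorial : ℝ) ≠ 0 := by positivity
  have h2 : ((l - k).factorial : ℝ) ≠ 0 := by positivity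
  have h3 : (l.factorial : ℝ) ≠ 0 := by positivity
  field_simp
  rw [← h]
  ring

/-- Adding independent Poisson noise of mean vector `s`. -/
theorem poissonOverlap_le_add {n : ℕ} {a b s : Fin n → ℝ}
    (ha : ∀ i, 0 ≤ a i) (hb : ∀ i, 0 ≤ b i) (hs : ∀ i, 0 ≤ s i) :
    poissonOverlap a b ≤ poissonOverlap (fun i => a i + s i) (fun i => b i + s i) := by
  have hmix : ∀ i (c : ℝ), 0 ≤ c → ∀ l, ∑' k, ENNReal.ofReal (poissonPdf c k) *
      (if k ≤ l then ENNReal.ofReal (poissonPdf (s i) (l - k)) else 0) =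
        ENNReal.ofReal (poissonPdf (c + s i) l) := by
    intro i c hc l
    rw [tsum_eq_sum (s := Finset.range (l + 1)), ← sum_poissonPdf_mul_poissonPdf,
      ENNReal.ofReal_sum_of_nonneg]
    · refine Finset.sum_congr rfl fun k hk => ?_
      rw [if_pos (Nat.lt_succ_iff.1 (Finset.mem_range.1 hk)),
        ENNReal.ofReal_mul (poissonPdf_nonneg hc _)]
    · exact fun k _ => mul_nonneg (poissonPdf_nonneg hc _) (poissonPdf_nonneg (hs i) _)
    · intro k hk
      rw [if_neg (by simpa [Nat.lt_succ_iff] using hk), mul_zero]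
  refine poissonOverlap_le_of_kernel ha hb (fun i => add_nonneg (ha i) (hs i))
    (fun i => add_nonneg (hb i) (hs i))
    (fun i k l => if k ≤ l then ENNReal.ofReal (poissonPdf (s i) (l - k)) else 0)
    (fun i k => ?_) (fun i => hmix i _ (ha i)) (fun i => hmix i _ (hb i))
  rw [ENNReal.tsum_eq_tsum_nat_add (l := k)]
  · simp [tsum_ofReal_poissonPdf (hs i)]
  · intro l hl
    rw [if_neg (not_le.2 hl)]

/-- An ordered pair of mean vectors is a degradation of any ordered pair with a larger gap. -/
theorem poissonOverlap_le_of_gap_le {n : ℕ} {d : ℝ} (hd : 0 ≤ d) {c lam mu : Fin n → ℝ}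
    (hc : ∀ i, 0 < c i) (hmu : ∀ i, 0 ≤ mu i) (hle : ∀ i, mu i ≤ lam i)
    (hgap : ∀ i, lam i - mu i ≤ c i) :
    poissonOverlap (fun i => c i + d) (fun _ => d) ≤
      poissonOverlap (fun i => lam i + d) (fun i => mu i + d) := by
  set t : Fin n → ℝ := fun i => (lam i - mu i) / c i with ht
  have ht0 : ∀ i, 0 ≤ t i := fun i => div_nonneg (sub_nonneg.2 (hle i)) (hc i).le
  have ht1 : ∀ i, t i ≤ 1 := fun i => (div_le_one (hc i)).2 (hgap i)
  have htc : ∀ i, t i * c i = lam i - mu i := fun i => div_mul_cancel₀ _ (hc i).ne'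
  have hs : ∀ i, 0 ≤ mu i + (1 - t i) * d := fun i =>
    add_nonneg (hmu i) (mul_nonneg (sub_nonneg.2 (ht1 i)) hd)
  have hcd : ∀ i, 0 ≤ c i + d := fun i => add_nonneg (hc i).le hd
  refine (poissonOverlap_le_thinning hcd (fun _ => hd) ht0 ht1).trans ?_
  refine (poissonOverlap_le_add (fun i => mul_nonneg (ht0 i) (hcd i))
    (fun i => mul_nonneg (ht0 i) hd) hs).trans_eq ?_
  congr 1 <;> ext i
  · linear_combination htc i
  · ring

/-- Restricting to counts produced by the common part of the means bounds the overlap below. -/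
theorem exp_neg_le_poissonOverlap {n : ℕ} {a b : Fin n → ℝ} (ha : ∀ i, 0 ≤ a i)
    (hb : ∀ i, 0 ≤ b i) {E : ℝ} (hE : ∑ i, (a i - min (a i) (b i)) ≤ E)
    (hE' : ∑ i, (b i - min (a i) (b i)) ≤ E) :
    ENNReal.ofReal (Real.exp (-E)) ≤ poissonOverlap a b := by
  set m : Fin n → ℝ := fun i => min (a i) (b i) with hm
  have hm0 : ∀ i, 0 ≤ m i := fun i => le_min (ha i) (hb i)
  have key : ∀ c : Fin n → ℝ, (∀ i, m i ≤ c i) → ∑ i, (c i - m i) ≤ E → ∀ y,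
      Real.exp (-E) * prodPdf m y ≤ prodPdf c y := by
    intro c hc hcE y
    calc Real.exp (-E) * prodPdf m y ≤ Real.exp (-∑ i, (c i - m i)) * prodPdf m y := by
          gcongr
          exact prodPdf_nonneg hm0 y
      _ = ∏ i, Real.exp (-(c i - m i)) * poissonPdf (m i) (y i) := by
          rw [← Finset.sum_neg_distrib, Real.exp_sum, prodPdf, Finset.prod_mul_distrib]
      _ ≤ prodPdf c y := by
          refine Finset.prod_le_prod
            (fun i _ => mul_nonneg (Real.exp_pos _).le (poissonPdf_nonneg (hm0 i) _))
            fun i _ => ?_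
          have h0 := hm0 i
          have h1 := hc i
          have hexp : Real.exp (-c i) = Real.exp (-(c i - m i)) * Real.exp (-m i) := by
            rw [← Real.exp_add]; ring_nf
          rw [poissonPdf, poissonPdf, hexp, mul_div_assoc, mul_div_assoc, ← mul_assoc]
          gcongr
  calc ENNReal.ofReal (Real.exp (-E))
      = ∑' y, ENNReal.ofReal (Real.exp (-E) * prodPdf m y) := by
        simp_rw [ENNReal.ofReal_mul (Real.exp_pos (-E)).le]
        rw [ENNReal.tsum_mul_left, tsum_ofReal_prodPdf hm0, mul_one]
    _ ≤ poissonOverlap a b := ENNReal.tsum_le_tsum fun y => le_min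
        (ENNReal.ofReal_le_ofReal (key a (fun i => min_le_left _ _) hE y))
        (ENNReal.ofReal_le_ofReal (key b (fun i => min_le_right _ _) hE' y))

theorem poissonPdf_rpow_mul_rpow {a b s : ℝ} (ha : 0 ≤ a) (hb : 0 ≤ b) (k : ℕ) :
    poissonPdf a k ^ s * poissonPdf b k ^ (1 - s) =
      Real.exp (-(s * a + (1 - s) * b)) *
        ((a ^ s * b ^ (1 - s)) ^ k / (Nat.factorial k : ℝ)) := by
  have hk : (0 : ℝ) < Nat.factorial k := by positivity
  have hf : (Nat.factorial k : ℝ) ^ s * (Nat.factorial k : ℝ) ^ (1 - s) = Nat.factorial k := by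
    rw [← Real.rpow_add hk]; simp
  have hpow : ∀ x r : ℝ, 0 ≤ x → (x ^ k) ^ r = (x ^ r) ^ k := fun x r hx => by
    rw [← Real.rpow_natCast, ← Real.rpow_natCast, ← Real.rpow_mul hx, ← Real.rpow_mul hx, mul_comm]
  unfold poissonPdf
  rw [Real.div_rpow (by positivity) hk.le, Real.div_rpow (by positivity) hk.le,
    Real.mul_rpow (by positivity) (by positivity), Real.mul_rpow (by positivity) (by positivity),
    ← Real.exp_mul, ← Real.exp_mul, hpow a s ha, hpow b _ hb, div_mul_div_comm, hf,
    mul_mul_mul_comm, ← Real.exp_add, mul_pow, mul_div_assoc]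
  ring_nf

/-- The Chernoff bound on the overlap. -/
theorem poissonOverlap_le_chernoff {n : ℕ} {a b : Fin n → ℝ} (ha : ∀ i, 0 ≤ a i)
    (hb : ∀ i, 0 ≤ b i) {s : ℝ} (hs : 0 ≤ s) (hs1 : s ≤ 1) :
    poissonOverlap a b ≤ ENNReal.ofReal (Real.exp
      (∑ i, (a i ^ s * b i ^ (1 - s) - (s * a i + (1 - s) * b i)))) := by
  have hs1' : 0 ≤ 1 - s := sub_nonneg.2 hs1
  have hmin : ∀ y, min (prodPdf a y) (prodPdf b y) ≤
      ∏ i, poissonPdf (a i) (y i) ^ s * poissonPdf (b i) (y i) ^ (1 - s) := by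
    intro y
    have h0 := le_min (prodPdf_nonneg ha y) (prodPdf_nonneg hb y)
    rw [Finset.prod_mul_distrib,
      Real.finsetProd_rpow _ _ fun i _ => poissonPdf_nonneg (ha i) _,
      Real.finsetProd_rpow _ _ fun i _ => poissonPdf_nonneg (hb i) _]
    calc min (prodPdf a y) (prodPdf b y)
        = min (prodPdf a y) (prodPdf b y) ^ s * min (prodPdf a y) (prodPdf b y) ^ (1 - s) := by
          rw [← Real.rpow_add_of_nonneg h0 hs hs1', add_sub_cancel, Real.rpow_one]
      _ ≤ prodPdf a y ^ s * prodPdf b y ^ (1 - s) := by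
          gcongr
          · exact Real.rpow_nonneg (prodPdf_nonneg ha y) _
          · exact min_le_left _ _
          · exact min_le_right _ _
  have h0 : ∀ i k, 0 ≤ poissonPdf (a i) k ^ s * poissonPdf (b i) k ^ (1 - s) := fun i k =>
    mul_nonneg (Real.rpow_nonneg (poissonPdf_nonneg (ha i) k) _)
      (Real.rpow_nonneg (poissonPdf_nonneg (hb i) k) _)
  have hsum : ∀ i, HasSum (fun k => poissonPdf (a i) k ^ s * poissonPdf (b i) k ^ (1 - s))
      (Real.exp (a i ^ s * b i ^ (1 - s) - (s * a i + (1 - s) * b i))) := by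
    intro i
    simp_rw [poissonPdf_rpow_mul_rpow (ha i) (hb i)]
    rw [sub_eq_neg_add (a i ^ s * b i ^ (1 - s)), Real.exp_add]
    exact (hasSum_pow_div_factorial _).mul_left _
  calc poissonOverlap a b
      ≤ ∑' y : Fin n → ℕ, ∏ i, ENNReal.ofReal
          (poissonPdf (a i) (y i) ^ s * poissonPdf (b i) (y i) ^ (1 - s)) := by
        refine ENNReal.tsum_le_tsum fun y => ?_
        rw [← ENNReal.ofReal_min, ← ENNReal.ofReal_prod_of_nonneg fun i _ => h0 i _]
        exact ENNReal.ofReal_le_ofReal (hmin y)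
    _ = _ := by
        rw [ENNReal.tsum_pi_prod fun i k => ENNReal.ofReal
          (poissonPdf (a i) k ^ s * poissonPdf (b i) k ^ (1 - s)), Real.exp_sum,
          ENNReal.ofReal_prod_of_nonneg fun i _ => (Real.exp_pos _).le]
        refine Finset.prod_congr rfl fun i _ => ?_
        rw [← ENNReal.ofReal_tsum_of_nonneg (h0 i) (hsum i).summable, (hsum i).tsum_eq]

theorem exists_forall_ge_sum_rpow_le {n : ℕ} {c : Fin n → ℝ} (hc : ∀ i, 0 ≤ c i) {d s δ : ℝ}
    (hd : 0 ≤ d) (hs : 0 ≤ s) (hs1 : s < 1) (hδ : 0 < δ) :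
    ∃ A₀ : ℝ, 0 < A₀ ∧ ∀ A, A₀ ≤ A → ∑ i, (A * c i + d) ^ s * d ^ (1 - s) ≤ A * δ := by
  set B := ∑ i, (c i + d) ^ s * d ^ (1 - s) with hB
  obtain ⟨A₁, hA₁⟩ := Filter.eventually_atTop.1
    ((tendsto_rpow_atTop (sub_pos.2 hs1)).eventually_ge_atTop (B / δ))
  refine ⟨max 1 A₁, by positivity, fun A hA => ?_⟩
  have h1 : 1 ≤ A := (le_max_left _ _).trans hA
  have hA0 : 0 < A := one_pos.trans_le h1
  have hB' : B ≤ A ^ (1 - s) * δ := (div_le_iff₀ hδ).1 (hA₁ A ((le_max_right _ _).trans hA))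
  calc ∑ i, (A * c i + d) ^ s * d ^ (1 - s)
      ≤ ∑ i, A ^ s * ((c i + d) ^ s * d ^ (1 - s)) := by
        refine Finset.sum_le_sum fun i _ => ?_
        have hci := hc i
        rw [← mul_assoc, ← Real.mul_rpow hA0.le (by positivity)]
        gcongr
        nlinarith
    _ = A ^ s * B := by rw [hB, Finset.mul_sum]
    _ ≤ A ^ s * (A ^ (1 - s) * δ) := by gcongr
    _ = A * δ := by
        rw [← mul_assoc, ← Real.rpow_add hA0, add_sub_cancel, Real.rpow_one]

/-- For large `A`, the pair of mean vectors `(A c, 0)` has the smallest overlap among all pairs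
with coordinates between `0` and `A c`. -/
theorem exists_forall_ge_poissonOverlap_le {n : ℕ} (hn : 0 < n) {c : Fin n → ℝ}
    (hc : ∀ i, 0 < c i) {d : ℝ} (hd : 0 ≤ d) :
    ∃ A₀ : ℝ, 0 < A₀ ∧ ∀ A, A₀ ≤ A → ∀ lam mu : Fin n → ℝ,
      (∀ i, 0 ≤ lam i ∧ lam i ≤ A * c i) → (∀ i, 0 ≤ mu i ∧ mu i ≤ A * c i) →
      poissonOverlap (fun i => A * c i + d) (fun _ => d) ≤
        poissonOverlap (fun i => lam i + d) (fun i => mu i + d) := by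
  have : Nonempty (Fin n) := ⟨⟨0, hn⟩⟩
  obtain ⟨i₀, hi₀⟩ := Finite.exists_min c
  have hη := hc i₀
  set C := ∑ i, c i with hC
  have hηC : c i₀ ≤ C := Finset.single_le_sum (fun i _ => (hc i).le) (Finset.mem_univ i₀)
  have hC0 : 0 < C := hη.trans_le hηC
  set s := 1 - c i₀ / (2 * C) with hs
  have hsC : s * C = C - c i₀ / 2 := by rw [hs]; field_simp
  have hs1 : s < 1 := by
    have : 0 < c i₀ / (2 * C) := by positivity
    linarith
  have hs0 : 0 ≤ s := by
    have : c i₀ / (2 * C) ≤ 1 := (div_le_one (by positivity)).2 (by linarith)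
    linarith
  obtain ⟨A₀, hA₀, h⟩ := exists_forall_ge_sum_rpow_le (fun i => (hc i).le) hd hs0 hs1 (half_pos hη)
  refine ⟨A₀, hA₀, fun A hA lam mu hl hm => ?_⟩
  have hA0 : 0 < A := hA₀.trans_le hA
  have hAc : ∀ i, 0 < A * c i := fun i => mul_pos hA0 (hc i)
  by_cases h1 : ∀ i, mu i ≤ lam i
  · exact poissonOverlap_le_of_gap_le hd hAc (fun i => (hm i).1) h1
      fun i => by linarith [(hm i).1, (hl i).2]
  by_cases h2 : ∀ i, lam i ≤ mu i
  · rw [poissonOverlap_comm (fun i => lam i + d)]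
    exact poissonOverlap_le_of_gap_le hd hAc (fun i => (hl i).1) h2
      fun i => by linarith [(hl i).1, (hm i).2]
  push Not at h1 h2
  have hgap : ∀ u v : Fin n → ℝ, (∀ i, 0 ≤ u i ∧ u i ≤ A * c i) → (∀ i, 0 ≤ v i) →
      (∃ i, u i < v i) → ∑ i, (u i + d - min (u i + d) (v i + d)) ≤ A * (C - c i₀) := by
    rintro u v hu hv ⟨j, hj⟩
    rw [← Finset.add_sum_erase _ _ (Finset.mem_univ j), min_eq_left (by linarith), sub_self,
      zero_add]
    calc ∑ i ∈ Finset.univ.erase j, (u i + d - min (u i + d) (v i + d))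
        ≤ ∑ i ∈ Finset.univ.erase j, A * c i := by
          refine Finset.sum_le_sum fun i _ => ?_
          have : d ≤ min (u i + d) (v i + d) :=
            le_min (by linarith [(hu i).1]) (by linarith [hv i])
          linarith [(hu i).2]
      _ = A * (C - c j) := by
          rw [← Finset.mul_sum, hC, ← Finset.add_sum_erase _ _ (Finset.mem_univ j),
            add_sub_cancel_left]
      _ ≤ A * (C - c i₀) := by gcongr; exact hi₀ j
  refine le_trans ?_ (exp_neg_le_poissonOverlap (fun i => add_nonneg (hl i).1 hd)
    (fun i => add_nonneg (hm i).1 hd) (hgap lam mu hl (fun i => (hm i).1) h1) ?_)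
  · refine (poissonOverlap_le_chernoff (fun i => add_nonneg (hAc i).le hd) (fun _ => hd)
      hs0 hs1.le).trans (ENNReal.ofReal_le_ofReal (Real.exp_le_exp.2 ?_))
    have hlin : A * s * C ≤ ∑ i, (s * (A * c i + d) + (1 - s) * d) := by
      rw [hC, Finset.mul_sum]
      exact Finset.sum_le_sum fun i _ => by linarith
    rw [Finset.sum_sub_distrib]
    have := h A hA
    nlinarith
  · simp_rw [min_comm (lam _ + d)]
    exact hgap mu lam hm (fun i => (hl i).1) h2

theorem cconv_const {N K : ℕ} (A : ℝ) (p : Fin K → ℝ) :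
    cconv (fun _ : Fin N => A) p = fun i => A * cconv (fun _ : Fin N => (1 : ℝ)) p i := by
  ext i
  simp only [cconv, Finset.mul_sum]
  refine Finset.sum_congr rfl fun j _ => ?_
  split_ifs <;> ring

theorem cconv_mono {N K : ℕ} {x x' : Fin N → ℝ} {p : Fin K → ℝ} (hp : ∀ j, 0 ≤ p j)
    (hx : ∀ i, x i ≤ x' i) (i : Fin (N + K - 1)) : cconv x p i ≤ cconv x' p i := by
  refine Finset.sum_le_sum fun j _ => mul_le_mul_of_nonneg_left ?_ (hp j)
  split_ifs
  · exact hx _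
  · exact le_rfl

theorem cconv_one_pos {N K : ℕ} (hN : 1 ≤ N) (hK : 1 ≤ K) {p : Fin K → ℝ} (hp : ∀ j, 0 < p j)
    (i : Fin (N + K - 1)) : 0 < cconv (fun _ : Fin N => (1 : ℝ)) p i := by
  have hi := i.2
  refine Finset.sum_pos' (fun j _ => mul_nonneg (hp j).le (by split_ifs <;> simp))
    ⟨⟨i - (N - 1), by omega⟩, Finset.mem_univ _, ?_⟩
  rw [dif_pos (by simp only; omega), mul_one]
  exact hp _

/-- Under a peak-power constraint only, with all channel coefficients strictly positive,
the on/off pair `x1* = (A,…,A)`, `x2* = (0,…,0)` is optimal for all sufficiently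
large peak power `A`. -/
theorem stmt3 (K : ℕ) (hK : 1 ≤ K) (p : Fin K → ℝ) (hp : ∀ j, 0 < p j)
    (d : ℝ) (hd : 0 < d) (N : ℕ) (hN : 1 ≤ N) :
    ∃ Astar : ℝ, 0 < Astar ∧ ∀ A : ℝ, Astar ≤ A →
      ∀ x1 x2 : Fin N → ℝ,
        (∀ i, 0 ≤ x1 i ∧ x1 i ≤ A) → (∀ i, 0 ≤ x2 i ∧ x2 i ≤ A) →
        Pe d (cconv (fun _ : Fin N => A) p) (cconv (fun _ : Fin N => (0:ℝ)) p)
          ≤ Pe d (cconv x1 p) (cconv x2 p) := by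

  have hc := cconv_one_pos hN hK hp
  obtain ⟨A₀, hA₀, h⟩ := exists_forall_ge_poissonOverlap_le (by omega) hc hd.le
  refine ⟨A₀, hA₀, fun A hA x1 x2 hx1 hx2 => ?_⟩
  have hA0 : 0 < A := hA₀.trans_le hA
  have hzero : cconv (fun _ : Fin N => (0 : ℝ)) p = fun _ => 0 := by
    rw [cconv_const]; simp
  have bounds : ∀ x : Fin N → ℝ, (∀ i, 0 ≤ x i ∧ x i ≤ A) → ∀ i,
      0 ≤ cconv x p i ∧ cconv x p i ≤ A * cconv (fun _ : Fin N => (1 : ℝ)) p i := fun x hx i =>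
    ⟨(congrFun hzero i).symm.trans_le (cconv_mono (fun j => (hp j).le) (fun i => (hx i).1) i),
      (cconv_mono (fun j => (hp j).le) (fun i => (hx i).2) i).trans_eq
        (congrFun (cconv_const A p) i)⟩
  have h1 := bounds x1 hx1
  have h2 := bounds x2 hx2
  have hnonneg : ∀ i, 0 ≤ cconv x1 p i + d := fun i => add_nonneg (h1 i).1 hd.le
  rw [hzero, cconv_const A, Pe_eq_poissonOverlap hnonneg fun i => add_nonneg (h2 i).1 hd.le,
    Pe_eq_poissonOverlap (fun i => by have := hc i; positivity) fun i => by simpa using hd.le]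
  refine div_le_div_of_nonneg_right (ENNReal.toReal_mono ?_ ?_) zero_le_two
  · exact ((poissonOverlap_le_one hnonneg _).trans_lt ENNReal.one_lt_top).ne
  · simpa using h A hA _ _ h1 h2
end

section
/- Let K ≥ 1, N ≥ K+1, π ∈ [0,∞)^K, P ≥ 0 and d > 0. Let T' be the set of pairs (λ, μ) of vectors in [0,∞)^{N+K−1} such that both λ and μ are weakly submajorized by v := (Pπ_0, …, Pπ_{K−1}, 0, …, 0) ∈ [0,∞)^{N+K−1}. Define λ* := (Pπ_0, …, Pπ_{K−1}, 0, …, 0) and μ* := (0, …, 0, Pπ_0, …, Pπ_{K−1}, 0, …, 0), where μ* has K leading zeros, then the entries Pπ_0, …, Pπ_{K−1}, then N−K−1 trailing zeros. Then (λ*, μ*) ∈ T' and for every (λ, μ) ∈ T', P_e(λ*, μ*) ≤ P_e(λ, μ). -/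
open scoped BigOperators

section

open MeasureTheory ProbabilityTheory
open scoped NNReal

theorem map_sum_pi_poissonMeasure {ι : Type*} [Fintype ι] (r : ι → ℝ≥0) :
    (Measure.pi fun i => poissonMeasure (r i)).map (fun z => ∑ i, z i) =
      poissonMeasure (∑ i, r i) := by
  classical
  have hind : iIndepFun (fun i (z : ι → ℕ) => z i) (Measure.pi fun i => poissonMeasure (r i)) :=
    iIndepFun_pi (X := fun _ => id) fun _ => aemeasurable_id
  have hsum : ∀ s : Finset ι, (Measure.pi fun i => poissonMeasure (r i)).map
      (∑ i ∈ s, fun z : ι → ℕ => z i) = poissonMeasure (∑ i ∈ s, r i) := by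
    intro s
    induction s using Finset.induction_on with
    | empty =>
      refine Measure.ext_of_singleton fun k => ?_
      rw [Measure.map_apply .of_discrete .of_discrete, poissonMeasure_singleton]
      rcases k with _ | k
      · simp [Set.preimage]
      · simp [Set.preimage]
    | insert i s hi ih =>
      rw [Finset.sum_insert hi, Finset.sum_insert hi, add_comm, add_comm (r i),
        (hind.indepFun_finsetSum_of_notMem (fun i => measurable_pi_apply i) hi).map_add_eq_map_conv_map
          .of_discrete .of_discrete, ih, (measurePreserving_eval _ i).map_eq,
        poissonMeasure_conv_poissonMeasure]
  rw [← hsum Finset.univ]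
  congr 1
  ext z
  simp

theorem map_comp_pi_of_injective {ι κ : Type*} [Fintype ι] [Fintype κ] {α : ι → Type*}
    [∀ i, MeasurableSpace (α i)] (μ : ∀ i, Measure (α i)) [∀ i, IsProbabilityMeasure (μ i)]
    {e : κ → ι} (he : e.Injective) :
    (Measure.pi μ).map (fun z k => z (e k)) = Measure.pi fun k => μ (e k) := by
  have hind : iIndepFun (fun i (z : ∀ i, α i) => z i) (Measure.pi μ) :=
    iIndepFun_pi (X := fun _ => id) fun _ => aemeasurable_id
  rw [(hind.precomp he).map_fun_eq_pi_map fun k => (measurable_pi_apply (e k)).aemeasurable]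
  congr 1
  ext1 k
  exact (measurePreserving_eval μ (e k)).map_eq

theorem map_swap_pi_pi {ι κ α : Type*} [Fintype ι] [Fintype κ] [Countable α] [MeasurableSpace α]
    [MeasurableSingletonClass α] (μ : ι → κ → Measure α) [∀ i k, IsProbabilityMeasure (μ i k)] :
    (Measure.pi fun i => Measure.pi fun k => μ i k).map (fun z k i => z i k) =
      Measure.pi fun k => Measure.pi fun i => μ i k := by
  refine Measure.ext_of_singleton fun y => ?_
  have hpre : (fun (z : ι → κ → α) k i => z i k) ⁻¹' {y} = {fun i k => y k i} := by
    ext z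
    simp only [Set.mem_preimage, Set.mem_singleton_iff, funext_iff]
    exact forall_comm
  rw [Measure.map_apply .of_discrete .of_discrete, hpre]
  simp only [Measure.pi_singleton]
  exact Finset.prod_comm

theorem map_row_sum_pi_poissonMeasure {ι κ η : Type*} [Fintype ι] [Fintype κ] [Fintype η]
    (r : ι → κ → ℝ≥0) {e : η → ι} (he : e.Injective) :
    (Measure.pi fun i => Measure.pi fun k => poissonMeasure (r i k)).map
        (fun z h => ∑ k, z (e h) k) =
      Measure.pi fun h => poissonMeasure (∑ k, r (e h) k) := by
  have hsum := map_sum_pi_poissonMeasure (ι := κ)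
  have hprob : ∀ i, IsProbabilityMeasure ((Measure.pi fun k => poissonMeasure (r i k)).map
      fun z => ∑ k, z k) := fun i => by rw [hsum]; infer_instance
  calc _ = ((Measure.pi fun i => Measure.pi fun k => poissonMeasure (r i k)).map
            (fun z h => z (e h))).map (fun z h => ∑ k, z h k) := by
        rw [Measure.map_map .of_discrete .of_discrete]; rfl
    _ = _ := by
        rw [map_comp_pi_of_injective (fun i => Measure.pi fun k => poissonMeasure (r i k)) he,
          Measure.pi_map_pi (f := fun _ (z : κ → ℕ) => ∑ k, z k) fun h => AEMeasurable.of_discrete]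
        simp only [hsum]

theorem map_col_sum_pi_poissonMeasure {ι κ η : Type*} [Fintype ι] [Fintype κ] [Fintype η]
    (r : ι → κ → ℝ≥0) {e : η → κ} (he : e.Injective) :
    (Measure.pi fun i => Measure.pi fun k => poissonMeasure (r i k)).map
        (fun z h => ∑ i, z i (e h)) =
      Measure.pi fun h => poissonMeasure (∑ i, r i (e h)) := by
  rw [← map_row_sum_pi_poissonMeasure (fun k i => r i k) he, ← map_swap_pi_pi,
    Measure.map_map .of_discrete .of_discrete]
  rfl

theorem measure_le_of_singleton_le {α : Type*} [Countable α] [MeasurableSpace α]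
    [MeasurableSingletonClass α] {μ ν : Measure α} {s : Set α}
    (h : ∀ x ∈ s, μ {x} ≤ ν {x}) : μ s ≤ ν s := by
  rw [← Measure.tsum_indicator_apply_singleton μ s s.to_countable.measurableSet,
    ← Measure.tsum_indicator_apply_singleton ν s s.to_countable.measurableSet]
  refine ENNReal.tsum_le_tsum fun x => ?_
  by_cases hx : x ∈ s <;> simp [hx, h]

/-- A maximum-likelihood acceptance region `t` minimizes the sum of the two error probabilities. -/
theorem measure_compl_add_le_of_likelihood {α : Type*} [Countable α] [MeasurableSpace α]
    [MeasurableSingletonClass α] {μ ν : Measure α} {s t : Set α}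
    (ht : ∀ x ∈ t, ν {x} ≤ μ {x}) (ht' : ∀ x ∉ t, μ {x} ≤ ν {x}) :
    μ tᶜ + ν t ≤ μ sᶜ + ν s := by
  have hm : ∀ u : Set α, MeasurableSet u := fun u => u.to_countable.measurableSet
  rw [← measure_inter_add_sdiff tᶜ (hm s), ← measure_inter_add_sdiff t (hm s),
    ← measure_inter_add_sdiff sᶜ (hm t), ← measure_inter_add_sdiff s (hm t)]
  have h₁ : μ (tᶜ ∩ s) ≤ ν (s \ t) := by
    rw [Set.inter_comm, ← Set.sdiff_eq]
    exact measure_le_of_singleton_le fun x hx => ht' x hx.2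
  have h₂ : ν (t \ s) ≤ μ (sᶜ ∩ t) := by
    rw [Set.inter_comm, ← Set.sdiff_eq]
    exact measure_le_of_singleton_le fun x hx => ht x hx.1
  have h₃ : tᶜ \ s = sᶜ \ t := by ext; simp [and_comm]
  rw [h₃, Set.inter_comm t s]
  calc _ ≤ ν (s \ t) + μ (sᶜ \ t) + (ν (s ∩ t) + μ (sᶜ ∩ t)) := by gcongr
    _ = _ := by ring

theorem prodPdf_eq_pi_real_singleton {n : ℕ} (a : Fin n → ℝ≥0) (y : Fin n → ℕ) :
    prodPdf (fun i => (a i : ℝ)) y = (Measure.pi fun i => poissonMeasure (a i)).real {y} := by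
  rw [measureReal_def, Measure.pi_singleton, ENNReal.toReal_prod]
  exact Finset.prod_congr rfl fun i _ => (poissonMeasure_real_singleton _ _).symm

theorem tsum_prodPdf_eq_pi_real {n : ℕ} (a : Fin n → ℝ≥0) (s : Set (Fin n → ℕ))
    [DecidablePred (· ∈ s)] :
    ∑' y, (if y ∈ s then prodPdf (fun i => (a i : ℝ)) y else 0) =
      (Measure.pi fun i => poissonMeasure (a i)).real s := by
  rw [measureReal_def, ← Measure.tsum_indicator_apply_singleton _ s .of_discrete,
    ENNReal.tsum_toReal_eq]
  · refine tsum_congr fun y => ?_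
    by_cases hy : y ∈ s <;> simp [hy, prodPdf_eq_pi_real_singleton, measureReal_def]
  · intro y
    by_cases hy : y ∈ s
    · simpa only [Set.indicator_of_mem hy] using measure_ne_top _ _
    · simp [hy]

theorem errProb_eq_measure {n : ℕ} {d : ℝ} {lam mu : Fin n → ℝ} {a b : Fin n → ℝ≥0}
    (ha : ∀ i, lam i + d = a i) (hb : ∀ i, mu i + d = b i) (g : (Fin n → ℕ) → Bool) :
    errProb d lam mu g =
      (1 / 2) * ((Measure.pi fun i => poissonMeasure (a i)) {y | g y = true}ᶜ +
        (Measure.pi fun i => poissonMeasure (b i)) {y | g y = true}).toReal := by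
  have h₁ := tsum_prodPdf_eq_pi_real a {y | g y = false}
  have h₂ := tsum_prodPdf_eq_pi_real b {y | g y = true}
  have hc : {y | g y = true}ᶜ = {y | g y = false} := by ext; simp
  simp only [Set.mem_ofPred_eq] at h₁ h₂
  simp only [errProb, ha, hb]
  rw [h₁, h₂, hc, ENNReal.toReal_add (measure_ne_top _ _) (measure_ne_top _ _), mul_add]
  rfl

/-- Splitting independent Poisson counts `x k` into parts with proportions `w i k` has a likelihood
depending on the means only through that of the totals. -/
theorem pi_poissonMeasure_split_singleton {ι κ : Type*} [Fintype ι] [Fintype κ]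
    (w : ι → κ → ℝ≥0) (hw : ∀ k, ∑ i, w i k = 1) (z : ι → κ → ℕ) :
    ∃ c : ℝ, 0 ≤ c ∧ ∀ x : κ → ℝ≥0,
      (Measure.pi fun i => Measure.pi fun k => poissonMeasure (w i k * x k)).real {z} =
        c * ∏ k, (poissonMeasure (x k)).real {∑ i, z i k} := by
  refine ⟨∏ k, ((∑ i, z i k).factorial : ℝ) * ∏ i, ((w i k : ℝ) ^ z i k / (z i k).factorial),
    by positivity, fun x => ?_⟩
  simp only [measureReal_def, Measure.pi_singleton, ENNReal.toReal_prod]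
  simp only [← measureReal_def, poissonMeasure_real_singleton]
  rw [Finset.prod_comm, ← Finset.prod_mul_distrib]
  refine Finset.prod_congr rfl fun k _ => ?_
  have hw' : ∑ i, (w i k : ℝ) = 1 := by exact_mod_cast hw k
  have hexp : ∏ i, Real.exp (-((w i k : ℝ) * x k)) = Real.exp (-(x k : ℝ)) := by
    rw [← Real.exp_sum, Finset.sum_neg_distrib, ← Finset.sum_mul, hw', one_mul]
  have hpow : ∏ i, (x k : ℝ) ^ z i k = (x k : ℝ) ^ ∑ i, z i k := Finset.prod_pow_eq_pow_sum _ _ _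
  calc _ = ∏ i, (Real.exp (-((w i k : ℝ) * x k)) * ((x k : ℝ) ^ z i k *
        ((w i k : ℝ) ^ z i k / (z i k).factorial))) := by
        refine Finset.prod_congr rfl fun i _ => ?_
        push_cast
        rw [mul_pow]
        ring
    _ = _ := by
        rw [Finset.prod_mul_distrib, Finset.prod_mul_distrib, hexp, hpow]
        field_simp

/-- Data processing: thinning the observations and adding independent Poisson noise of mean `s`
cannot decrease the minimal error probability. -/
theorem Pe_le_of_thinning {n : ℕ} {d : ℝ} {lam mu lam' mu' : Fin n → ℝ} {a b s : Fin n → ℝ≥0}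
    {D : Fin n → Fin n → ℝ≥0} (hD : ∀ j, ∑ i, D i j ≤ 1)
    (ha : ∀ i, lam i + d = a i) (hb : ∀ i, mu i + d = b i)
    (ha' : ∀ i, lam' i + d = (s i + ∑ j, D i j * a j : ℝ≥0))
    (hb' : ∀ i, mu' i + d = (s i + ∑ j, D i j * b j : ℝ≥0)) :
    Pe d lam mu ≤ Pe d lam' mu' := by
  set S : ℝ≥0 := 1 + ∑ i, s i with hS
  have hS0 : S ≠ 0 := by positivity
  -- Row `none` collects discarded counts; column `none` is the source of the noise.
  let w : Option (Fin n) → Option (Fin n) → ℝ≥0 := fun i j =>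
    i.elim (j.elim (1 / S) fun j => 1 - ∑ i, D i j) fun i => j.elim (s i / S) fun j => D i j
  have hw : ∀ j, ∑ i, w i j = 1 := by
    intro j
    rw [Fintype.sum_option]
    cases j with
    | none =>
      simp only [w, Option.elim]
      rw [← Finset.sum_div, ← add_div, ← hS, div_self hS0]
    | some j => simpa [w] using tsub_add_cancel_of_le (hD j)
  let x : (Fin n → ℝ≥0) → Option (Fin n) → ℝ≥0 := fun c j => j.elim S c
  let R : (Fin n → ℝ≥0) → Measure (Option (Fin n) → Option (Fin n) → ℕ) := fun c =>
    Measure.pi fun i => Measure.pi fun j => poissonMeasure (w i j * x c j)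
  have hrow : ∀ c : Fin n → ℝ≥0, (R c).map (fun z i => ∑ j, z (some i) j) =
      Measure.pi fun i => poissonMeasure (s i + ∑ j, D i j * c j) := by
    intro c
    rw [map_row_sum_pi_poissonMeasure _ (Option.some_injective _)]
    congr 1
    ext1 i
    rw [Fintype.sum_option]
    simp [w, x, hS0]
  have hcol : ∀ c : Fin n → ℝ≥0, (R c).map (fun z j => ∑ i, z i (some j)) =
      Measure.pi fun j => poissonMeasure (c j) := by
    intro c
    rw [map_col_sum_pi_poissonMeasure _ (Option.some_injective _)]
    congr 1
    ext1 j
    rw [← Finset.sum_mul, hw, one_mul]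
    rfl
  have hlik : ∀ z, ∃ c : ℝ, 0 ≤ c ∧ ∀ e : Fin n → ℝ≥0, (R e).real {z} =
      c * prodPdf (fun i => (e i : ℝ)) (fun j => ∑ i, z i (some j)) := by
    intro z
    obtain ⟨c, hc, h⟩ := pi_poissonMeasure_split_singleton w hw z
    refine ⟨c * (poissonMeasure S).real {∑ i, z i none}, by positivity, fun e => ?_⟩
    rw [h, Fintype.prod_option, prodPdf_eq_pi_real_singleton, mul_assoc]
    simp only [measureReal_def, Measure.pi_singleton, ENNReal.toReal_prod]
    rfl
  classical
  let gStar : (Fin n → ℕ) → Bool := fun y =>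
    decide (prodPdf (fun i => (b i : ℝ)) y ≤ prodPdf (fun i => (a i : ℝ)) y)
  refine le_ciInf fun g => ?_
  have hbdd : BddBelow (Set.range (errProb d lam mu)) := by
    refine ⟨0, ?_⟩
    rintro _ ⟨g, rfl⟩
    rw [errProb_eq_measure ha hb]
    positivity
  refine (ciInf_le hbdd gStar).trans ?_
  rw [errProb_eq_measure ha hb, errProb_eq_measure ha' hb', ← hrow, ← hrow, ← hcol, ← hcol]
  simp only [Measure.map_apply Measurable.of_discrete MeasurableSet.of_discrete]
  have hR : ∀ c, IsProbabilityMeasure (R c) := fun c => inferInstance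
  refine mul_le_mul_of_nonneg_left (ENNReal.toReal_mono
    (ENNReal.add_ne_top.2 ⟨measure_ne_top _ _, measure_ne_top _ _⟩) ?_) (by norm_num)
  simp only [Set.preimage_compl]
  have hle : ∀ e f : Fin n → ℝ≥0, ∀ z,
      prodPdf (fun i => (e i : ℝ)) (fun j => ∑ i, z i (some j)) ≤
        prodPdf (fun i => (f i : ℝ)) (fun j => ∑ i, z i (some j)) → R e {z} ≤ R f {z} := by
    intro e f z h
    obtain ⟨c, hc, hz⟩ := hlik z
    rw [← ENNReal.toReal_le_toReal (measure_ne_top _ _) (measure_ne_top _ _)]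
    change (R e).real {z} ≤ (R f).real {z}
    rw [hz, hz]
    exact mul_le_mul_of_nonneg_left h hc
  refine measure_compl_add_le_of_likelihood (fun z hz => hle _ _ _ ?_) (fun z hz => hle _ _ _ ?_)
  · simpa [gStar] using hz
  · simp only [gStar, Set.mem_preimage, Set.mem_ofPred_eq, decide_eq_true_eq, not_le] at hz
    exact hz.le

theorem sum_le_topSum {m : ℕ} (v : Fin m → ℝ) (s : Finset (Fin m)) :
    ∑ i ∈ s, v i ≤ topSum v s.card := by
  have h := le_ciSup (f := fun t : Finset (Fin m) =>
    ⨆ _ : t ∈ {t : Finset (Fin m) | t.card = s.card}, ∑ i ∈ t, v i)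
    (Set.finite_range _).bddAbove s
  simpa [topSum] using h

theorem topSum_le {m k : ℕ} {v : Fin m → ℝ} {c : ℝ} (hc : 0 ≤ c)
    (h : ∀ s : Finset (Fin m), s.card = k → ∑ i ∈ s, v i ≤ c) : topSum v k ≤ c :=
  Real.iSup_le (fun s => Real.iSup_le (fun hs => h s hs) hc) hc

theorem topSum_nonneg {m : ℕ} {v : Fin m → ℝ} (hv : ∀ i, 0 ≤ v i) (k : ℕ) : 0 ≤ topSum v k :=
  Real.iSup_nonneg fun _ => Real.iSup_nonneg fun _ => Finset.sum_nonneg fun i _ => hv i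

theorem topSum_mono {m : ℕ} {u v : Fin m → ℝ} (hv : ∀ i, 0 ≤ v i) (huv : ∀ i, u i ≤ v i) (k : ℕ) :
    topSum u k ≤ topSum v k :=
  topSum_le (topSum_nonneg hv k) fun s hs =>
    (Finset.sum_le_sum fun i _ => huv i).trans (hs ▸ sum_le_topSum v s)

theorem weakSubmaj_comp_perm {m : ℕ} {v : Fin m → ℝ} (hv : ∀ i, 0 ≤ v i)
    (σ : Equiv.Perm (Fin m)) : weakSubmaj (fun i => v (σ i)) v := by
  refine fun k _ _ => topSum_le (topSum_nonneg hv k) fun s hs => ?_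
  have h := sum_le_topSum v (s.map σ.toEmbedding)
  rwa [Finset.sum_map, Finset.card_map, hs] at h

theorem exists_perm_antitone {m : ℕ} (v : Fin m → ℝ) :
    ∃ σ : Equiv.Perm (Fin m), Antitone fun i => v (σ i) :=
  ⟨Tuple.sort fun i => -v i, fun _ _ h =>
    neg_le_neg_iff.1 (Tuple.monotone_sort (fun i => -v i) h)⟩

theorem Antitone.sum_le_sum_castLE {m k : ℕ} (hk : k ≤ m) {w : Fin m → ℝ} (hw : Antitone w)
    {s : Finset (Fin m)} (hs : s.card = k) :
    ∑ i ∈ s, w i ≤ ∑ i : Fin k, w (Fin.castLE hk i) := by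
  have hle : ∀ i : Fin k, Fin.castLE hk i ≤ s.orderEmbOfFin hs i := by
    rintro ⟨i, hi⟩
    rw [Fin.le_def]
    induction i with
    | zero => simp
    | succ i ih =>
      have h₁ := ih (by omega)
      have h₂ : s.orderEmbOfFin hs ⟨i, by omega⟩ < s.orderEmbOfFin hs ⟨i + 1, hi⟩ := by
        simp [Fin.lt_def]
      rw [Fin.lt_def] at h₂
      simp only [Fin.val_castLE] at h₁ ⊢
      omega
  conv_lhs => rw [← Finset.map_orderEmbOfFin_univ s hs, Finset.sum_map]
  exact Finset.sum_le_sum fun i _ => hw (hle i)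

theorem sum_mul_nonneg_of_partial_sums_nonneg (m : ℕ) {w c : ℕ → ℝ} (hw : ∀ k < m, 0 ≤ w k)
    (hanti : ∀ k, k + 1 < m → w (k + 1) ≤ w k)
    (hc : ∀ k ≤ m, 0 ≤ ∑ i ∈ Finset.range k, c i) :
    0 ≤ ∑ i ∈ Finset.range m, w i * c i := by
  have key : ∀ k, k + 1 ≤ m → w k * ∑ i ∈ Finset.range (k + 1), c i ≤
      ∑ i ∈ Finset.range (k + 1), w i * c i := by
    intro k
    induction k with
    | zero => simp
    | succ k ih =>
      intro hk
      rw [Finset.sum_range_succ c, Finset.sum_range_succ fun i => w i * c i, mul_add]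
      have h := mul_le_mul_of_nonneg_right (hanti k hk) (hc (k + 1) (by omega))
      linarith [ih (by omega)]
  rcases m with _ | m
  · simp
  · exact (mul_nonneg (hw m (by omega)) (hc _ le_rfl)).trans (key m le_rfl)

theorem sum_mul_le_sum_mul_of_partial_sums_le {m : ℕ} {w u v : Fin m → ℝ} (hw : ∀ i, 0 ≤ w i)
    (hanti : Antitone w)
    (h : ∀ k (hk : k ≤ m), ∑ i : Fin k, u (Fin.castLE hk i) ≤ ∑ i : Fin k, v (Fin.castLE hk i)) :
    ∑ i, w i * u i ≤ ∑ i, w i * v i := by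
  let w' : ℕ → ℝ := fun i => if hi : i < m then w ⟨i, hi⟩ else 0
  let c : ℕ → ℝ := fun i => if hi : i < m then v ⟨i, hi⟩ - u ⟨i, hi⟩ else 0
  have key := sum_mul_nonneg_of_partial_sums_nonneg m (w := w') (c := c)
    (fun k hk => by simp [w', hk, hw])
    (fun k hk => by
      simp only [w', hk, (Nat.lt_succ_self k).trans hk, dite_true]
      exact hanti (Fin.mk_le_mk.2 k.le_succ))
    (fun k hk => by
      have hck : ∀ i : Fin k, c i = v (Fin.castLE hk i) - u (Fin.castLE hk i) := fun i => by
        simp only [c, i.is_lt.trans_le hk, dite_true]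
        rfl
      rw [← Fin.sum_univ_eq_sum_range]
      simpa only [hck, Finset.sum_sub_distrib, sub_nonneg] using h k hk)
  rw [← Fin.sum_univ_eq_sum_range] at key
  simp only [w', c, Fin.is_lt, dite_true, Fin.eta, mul_sub, Finset.sum_sub_distrib] at key
  linarith

/-- A nonnegative vector weakly submajorized by a nonnegative `v` is the image of `v` under a doubly
substochastic matrix. -/
theorem exists_doublySubstochastic_of_weakSubmaj {m : ℕ} {u v : Fin m → ℝ} (hu : ∀ i, 0 ≤ u i)
    (h : weakSubmaj u v) (hv : ∀ i, 0 ≤ v i) :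
    ∃ D : Fin m → Fin m → ℝ, (∀ i j, 0 ≤ D i j) ∧ (∀ i, ∑ j, D i j ≤ 1) ∧
      (∀ j, ∑ i, D i j ≤ 1) ∧ ∀ i, ∑ j, D i j * v j = u i := by
  classical
  let C : Set (Fin m → Fin m → ℝ) :=
    {D | (∀ i j, 0 ≤ D i j) ∧ (∀ i, ∑ j, D i j ≤ 1) ∧ ∀ j, ∑ i, D i j ≤ 1}
  let T : (Fin m → Fin m → ℝ) →ₗ[ℝ] (Fin m → ℝ) :=
    { toFun := fun D i => ∑ j, D i j * v j
      map_add' := fun D E => by ext i; simp [add_mul, Finset.sum_add_distrib]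
      map_smul' := fun c D => by ext i; simp [Finset.mul_sum, mul_assoc] }
  suffices hmem : u ∈ T '' C by
    obtain ⟨D, ⟨h₁, h₂, h₃⟩, hD⟩ := hmem
    exact ⟨D, h₁, h₂, h₃, fun i => congrFun hD i⟩
  have hconv : Convex ℝ C := by
    rintro D ⟨hD₁, hD₂, hD₃⟩ E ⟨hE₁, hE₂, hE₃⟩ a b ha hb hab
    refine ⟨fun i j => ?_, fun i => ?_, fun j => ?_⟩
    · have := mul_nonneg ha (hD₁ i j)
      have := mul_nonneg hb (hE₁ i j)
      simp only [Pi.add_apply, Pi.smul_apply, smul_eq_mul]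
      linarith
    · simp only [Pi.add_apply, Pi.smul_apply, smul_eq_mul, Finset.sum_add_distrib, ← Finset.mul_sum]
      nlinarith [hD₂ i, hE₂ i]
    · simp only [Pi.add_apply, Pi.smul_apply, smul_eq_mul, Finset.sum_add_distrib, ← Finset.mul_sum]
      nlinarith [hD₃ j, hE₃ j]
  have hclosed : IsClosed C := by
    simp only [C, Set.ofPred_and, Set.ofPred_forall]
    refine .inter (isClosed_iInter fun i => isClosed_iInter fun j => ?_)
      (.inter (isClosed_iInter fun i => ?_) (isClosed_iInter fun j => ?_))
    · exact isClosed_le (by fun_prop) (by fun_prop)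
    · exact isClosed_le (by fun_prop) (by fun_prop)
    · exact isClosed_le (by fun_prop) (by fun_prop)
  have hcompact : IsCompact C := by
    refine (isCompact_Icc (a := (0 : Fin m → Fin m → ℝ)) (b := 1)).of_isClosed_subset hclosed ?_
    rintro D ⟨h₁, h₂, -⟩
    refine ⟨fun i j => h₁ i j, fun i j => ?_⟩
    exact (Finset.single_le_sum (fun j _ => h₁ i j) (Finset.mem_univ j)).trans (h₂ i)
  have hT : Continuous T := T.continuous_of_finiteDimensional
  by_contra hmem
  obtain ⟨f, c, hf, hcu⟩ := geometric_hahn_banach_closed_point (hconv.linear_image T)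
    (hcompact.image hT).isClosed hmem
  let w : Fin m → ℝ := fun i => f (Pi.single i 1)
  have hfw : ∀ x, f x = ∑ i, w i * x i := by
    intro x
    conv_lhs => rw [pi_eq_sum_univ x, map_sum]
    refine Finset.sum_congr rfl fun i _ => ?_
    rw [map_smul, smul_eq_mul, mul_comm]
    congr 2
    ext j
    simp [Pi.single_apply, eq_comm]
  let wp : Fin m → ℝ := fun i => max (w i) 0
  have hwp : ∀ i, 0 ≤ wp i := fun i => le_max_right _ _
  obtain ⟨σ, hσ⟩ := exists_perm_antitone wp
  obtain ⟨τ, hτ⟩ := exists_perm_antitone v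
  let D : Fin m → Fin m → ℝ := fun i j => if 0 < w i ∧ τ (σ.symm i) = j then 1 else 0
  have hDC : D ∈ C := by
    refine ⟨fun i j => by dsimp only [D]; split_ifs <;> norm_num, fun i => ?_, fun j => ?_⟩
    · by_cases hi : 0 < w i <;> simp [D, hi]
    · calc ∑ i, D i j ≤ ∑ i, if σ (τ.symm j) = i then (1 : ℝ) else 0 := by
            refine Finset.sum_le_sum fun i _ => ?_
            dsimp only [D]
            by_cases hj : τ (σ.symm i) = j
            · subst hj
              split_ifs <;> simp_all
            · split_ifs <;> simp_all
        _ = 1 := by simp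
        _ ≤ 1 := le_rfl
  have hfD : f (T D) = ∑ k, wp (σ k) * v (τ k) := by
    rw [hfw, ← Equiv.sum_comp σ]
    refine Finset.sum_congr rfl fun k _ => ?_
    by_cases hk : 0 < w (σ k)
    · simp [T, D, wp, hk, max_eq_left hk.le]
    · simp [T, D, wp, hk, max_eq_right (not_lt.1 hk)]
  have hfu : f u ≤ ∑ k, wp (σ k) * u (σ k) := by
    rw [hfw, Equiv.sum_comp σ fun i => wp i * u i]
    exact Finset.sum_le_sum fun i _ => mul_le_mul_of_nonneg_right (le_max_left _ _) (hu i)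
  have hpartial : ∀ k (hk : k ≤ m),
      ∑ i : Fin k, u (σ (Fin.castLE hk i)) ≤ ∑ i : Fin k, v (τ (Fin.castLE hk i)) := by
    intro k hk
    rcases Nat.eq_zero_or_pos k with rfl | hk0
    · simp
    have h₁ : ∑ i : Fin k, u (σ (Fin.castLE hk i)) ≤ topSum u k := by
      have := sum_le_topSum u
        (Finset.univ.map ((Fin.castLEEmb hk).trans σ.toEmbedding))
      simpa [Finset.sum_map] using this
    have h₂ : topSum v k ≤ ∑ i : Fin k, v (τ (Fin.castLE hk i)) := by
      refine topSum_le (Finset.sum_nonneg fun i _ => hv _) fun s hs => ?_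
      have := hτ.sum_le_sum_castLE hk (s := s.map τ.symm.toEmbedding) (by simpa using hs)
      simpa [Finset.sum_map] using this
    exact h₁.trans ((h k hk0 hk).trans h₂)
  have := sum_mul_le_sum_mul_of_partial_sums_le (u := fun k => u (σ k)) (v := fun k => v (τ k))
    (fun k => hwp (σ k)) hσ hpartial
  have := hf _ (Set.mem_image_of_mem T hDC)
  linarith

theorem weakSubmaj.of_le {m : ℕ} {u u' v : Fin m → ℝ} (h : weakSubmaj u v) (hu : ∀ i, 0 ≤ u i)
    (hle : ∀ i, u' i ≤ u i) : weakSubmaj u' v :=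
  fun k hk hkm => (topSum_mono hu hle k).trans (h k hk hkm)

/-- Among pairs weakly submajorized by `v`, the minimal error probability is least for two
rearrangements of `v` with disjoint supports. -/
theorem Pe_comp_perm_le_of_weakSubmaj {n : ℕ} {d : ℝ} (hd : 0 ≤ d) {v lam mu : Fin n → ℝ}
    (hv : ∀ i, 0 ≤ v i) (σ : Equiv.Perm (Fin n)) (hσ : ∀ j, v j = 0 ∨ v (σ j) = 0)
    (hlam : ∀ i, 0 ≤ lam i) (hmu : ∀ i, 0 ≤ mu i)
    (hlamv : weakSubmaj lam v) (hmuv : weakSubmaj mu v) :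
    Pe d v (fun i => v (σ i)) ≤ Pe d lam mu := by
  classical
  set c : Fin n → ℝ := fun i => min (lam i) (mu i) with hc
  have hc0 : ∀ i, 0 ≤ c i := fun i => le_min (hlam i) (hmu i)
  have hcl : ∀ i, c i ≤ lam i := fun i => min_le_left _ _
  have hcm : ∀ i, c i ≤ mu i := fun i => min_le_right _ _
  obtain ⟨D₁, hD₁, hrow₁, hcol₁, hval₁⟩ := exists_doublySubstochastic_of_weakSubmaj
    (u := fun i => lam i - c i) (fun i => sub_nonneg.2 (hcl i))
    (hlamv.of_le hlam fun i => sub_le_self _ (hc0 i)) hv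
  obtain ⟨D₂, hD₂, hrow₂, hcol₂, hval₂⟩ := exists_doublySubstochastic_of_weakSubmaj
    (u := fun i => mu i - c i) (fun i => sub_nonneg.2 (hcm i))
    (hmuv.of_le hmu fun i => sub_le_self _ (hc0 i)) hv
  -- Rows carrying excess of `lam` draw on the support of `v`, the other rows on its complement.
  let D : Fin n → Fin n → ℝ := fun i j =>
    if mu i < lam i then (if v j = 0 then 0 else D₁ i j) else (if v j = 0 then D₂ i (σ j) else 0)
  have hD : ∀ i j, 0 ≤ D i j := fun i j => by
    dsimp only [D]
    split_ifs <;> simp [hD₁, hD₂]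
  have hrow : ∀ i, ∑ j, D i j ≤ 1 := fun i => by
    by_cases hi : mu i < lam i
    · refine (Finset.sum_le_sum fun j _ => ?_).trans (hrow₁ i)
      by_cases hj : v j = 0 <;> simp [D, hi, hj, hD₁]
    · refine (Finset.sum_le_sum fun j _ => ?_).trans
        ((Equiv.sum_comp σ fun j => D₂ i j).trans_le (hrow₂ i))
      by_cases hj : v j = 0 <;> simp [D, hi, hj, hD₂]
  have hcol : ∀ j, ∑ i, D i j ≤ 1 := fun j => by
    by_cases hj : v j = 0
    · refine (Finset.sum_le_sum fun i _ => ?_).trans (hcol₂ (σ j))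
      by_cases hi : mu i < lam i <;> simp [D, hi, hj, hD₂]
    · refine (Finset.sum_le_sum fun i _ => ?_).trans (hcol₁ j)
      by_cases hi : mu i < lam i <;> simp [D, hi, hj, hD₁]
  have hlamD : ∀ i, ∑ j, D i j * v j = lam i - c i := fun i => by
    by_cases hi : mu i < lam i
    · rw [← hval₁]
      refine Finset.sum_congr rfl fun j _ => ?_
      by_cases hj : v j = 0 <;> simp [D, hi, hj]
    · have : lam i - c i = 0 := by simp [hc, not_lt.1 hi]
      rw [this]
      refine Finset.sum_eq_zero fun j _ => ?_
      by_cases hj : v j = 0 <;> simp [D, hi, hj]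
  have hmuD : ∀ i, ∑ j, D i j * v (σ j) = mu i - c i := fun i => by
    by_cases hi : mu i < lam i
    · have : mu i - c i = 0 := by simp [hc, hi.le]
      rw [this]
      refine Finset.sum_eq_zero fun j _ => ?_
      rcases hσ j with hj | hj <;> simp [D, hi, hj]
    · rw [← hval₂, ← Equiv.sum_comp σ fun j => D₂ i j * v j]
      refine Finset.sum_congr rfl fun j _ => ?_
      by_cases hj : v j = 0
      · simp [D, hi, hj]
      · simp [D, hi, hj, (hσ j).resolve_left hj]
  have hs : ∀ i, 0 ≤ c i + d * (1 - ∑ j, D i j) := fun i =>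
    add_nonneg (hc0 i) (mul_nonneg hd (sub_nonneg.2 (hrow i)))
  have hv₁ : ∀ i, 0 ≤ v i + d := fun i => add_nonneg (hv i) hd
  refine Pe_le_of_thinning (D := fun i j => (D i j).toNNReal)
    (s := fun i => (c i + d * (1 - ∑ j, D i j)).toNNReal) (a := fun i => (v i + d).toNNReal)
    (b := fun i => (v (σ i) + d).toNNReal) (fun j => ?_)
    (fun i => (Real.coe_toNNReal _ (hv₁ i)).symm) (fun i => (Real.coe_toNNReal _ (hv₁ (σ i))).symm)
    (fun i => ?_) fun i => ?_
  · rw [← NNReal.coe_le_coe, NNReal.coe_sum]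
    simpa only [Real.coe_toNNReal _ (hD _ _), NNReal.coe_one] using hcol j
  · simp only [NNReal.coe_add, NNReal.coe_sum, NNReal.coe_mul, Real.coe_toNNReal _ (hD _ _),
      Real.coe_toNNReal _ (hs _), Real.coe_toNNReal _ (hv₁ _), mul_add, Finset.sum_add_distrib,
      hlamD, ← Finset.sum_mul]
    ring
  · simp only [NNReal.coe_add, NNReal.coe_sum, NNReal.coe_mul, Real.coe_toNNReal _ (hD _ _),
      Real.coe_toNNReal _ (hs _), Real.coe_toNNReal _ (hv₁ _), mul_add, Finset.sum_add_distrib,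
      hmuD, ← Finset.sum_mul]
    ring

/-- The permutation of `Fin n` exchanging `i` and `i + k` for `i < k`. -/
def blockSwap {n k : ℕ} (h : 2 * k ≤ n) : Equiv.Perm (Fin n) :=
  Function.Involutive.toPerm
    (fun i => ⟨if (i : ℕ) < k then i + k else if (i : ℕ) < 2 * k then i - k else i, by
      have := i.is_lt
      split_ifs <;> omega⟩)
    fun i => by
      ext
      dsimp only
      split_ifs <;> omega

theorem val_blockSwap {n k : ℕ} (h : 2 * k ≤ n) (i : Fin n) :
    (blockSwap h i : ℕ) =
      if (i : ℕ) < k then (i : ℕ) + k else if (i : ℕ) < 2 * k then (i : ℕ) - k else i :=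
  rfl

end

/-- Relaxed optimization over the set `T'` of pairs of nonnegative vectors weakly
submajorized by `v = (Pπ₀,…,Pπ_{K−1},0,…,0)`: the pair
`λ* = (Pπ₀,…,Pπ_{K−1},0,…,0)`, `μ* = (0,…,0,Pπ₀,…,Pπ_{K−1},0,…,0)` (with `K` leading
zeros) belongs to `T'` and minimizes the ML error probability over `T'`. -/
theorem stmt6 (K N : ℕ) (hK : 1 ≤ K) (hN : K + 1 ≤ N)
    (p : Fin K → ℝ) (hp : ∀ j, 0 ≤ p j)
    (P : ℝ) (hP : 0 ≤ P) (d : ℝ) (hd : 0 < d)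
    (v lamStar muStar : Fin (N + K - 1) → ℝ)
    (hv : ∀ i : Fin (N + K - 1), v i = if h : (i : ℕ) < K then P * p ⟨(i : ℕ), h⟩ else 0)
    (hls : ∀ i : Fin (N + K - 1),
      lamStar i = if h : (i : ℕ) < K then P * p ⟨(i : ℕ), h⟩ else 0)
    (hms : ∀ i : Fin (N + K - 1),
      muStar i = if h : K ≤ (i : ℕ) ∧ (i : ℕ) - K < K then P * p ⟨(i : ℕ) - K, h.2⟩ else 0) :
    (weakSubmaj lamStar v ∧ weakSubmaj muStar v) ∧
    ∀ lam mu : Fin (N + K - 1) → ℝ,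
      (∀ i, 0 ≤ lam i) → (∀ i, 0 ≤ mu i) →
      weakSubmaj lam v → weakSubmaj mu v →
      Pe d lamStar muStar ≤ Pe d lam mu := by
  obtain rfl : lamStar = v := funext fun i => (hls i).trans (hv i).symm
  have hn : 2 * K ≤ N + K - 1 := by omega
  have hv0 : ∀ i, 0 ≤ lamStar i := fun i => by
    rw [hv]
    split_ifs
    · exact mul_nonneg hP (hp _)
    · exact le_rfl
  obtain rfl : muStar = fun i => lamStar (blockSwap hn i) := by
    funext i
    have hval := val_blockSwap hn i
    rw [hms, hv]
    by_cases h₁ : (i : ℕ) < K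
    · rw [if_pos h₁] at hval
      rw [dif_neg (by omega), dif_neg (by omega)]
    · rw [if_neg h₁] at hval
      by_cases h₂ : (i : ℕ) < 2 * K
      · rw [if_pos h₂] at hval
        rw [dif_pos (by omega), dif_pos (by omega)]
        simp only [hval]
      · rw [if_neg h₂] at hval
        rw [dif_neg (by omega), dif_neg (by omega)]
  have hdisj : ∀ j, lamStar j = 0 ∨ lamStar (blockSwap hn j) = 0 := fun j => by
    by_cases hj : (j : ℕ) < K
    · exact .inr (by rw [hv, dif_neg (by rw [val_blockSwap, if_pos hj]; omega)])
    · exact .inl (by rw [hv, dif_neg hj])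
  exact ⟨⟨fun k _ _ => le_rfl, weakSubmaj_comp_perm hv0 _⟩, fun lam mu hlam hmu hlamv hmuv =>
    Pe_comp_perm_le_of_weakSubmaj hd.le hv0 _ hdisj hlam hmu hlamv hmuv⟩
end
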